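/- arXiv:2203.00397 — 2 statements merged into one kernel-verified Lean document; each statement's English description precedes it below -/
import Mathlib

section
/- Let M = (S, A, R, T, γ) be a finite MDP and φ : S → S_φ a state abstraction with weighting function w. For each state s let N(s) = Σ_{b∈A} Q*(s,b), and assume N(s) > 0 for all s. Suppose there are ε ≥ 0 and k ≥ 0 such that whenever φ(s1) = φ(s2): for every action a, |Q*(s1,a)/N(s1) − Q*(s2,a)/N(s2)| ≤ ε, and |N(s1) − N(s2)| ≤ k·ε. Then (i) whenever φ(s1)=φ(s2), for all a, |Q*(s1,a) − Q*(s2,a)| ≤ ε·(k + |A|·RMax/(1−γ)); and (ii) for an optimal deterministic policy π*_φ of M_φ, for every state s, V*(s) − V^{π*_φ∘φ}(s) ≤ 2ε·(k + |A|·RMax/(1−γ))/(1−γ)². -/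
open Finset

/-- A function on a finite type whose upper bounds `B` improve to `c + γ * B`, with `γ < 1`,
is bounded by `c / (1 - γ)`. -/
lemma le_div_one_sub_of_contracting {ι : Type*} [Finite ι] (f : ι → ℝ) {c γ : ℝ} (hγ : γ < 1)
    (h : ∀ B, (∀ i, f i ≤ B) → ∀ i, f i ≤ c + γ * B) (i : ι) : f i ≤ c / (1 - γ) := by
  have : Nonempty ι := ⟨i⟩
  obtain ⟨j, hj⟩ := Finite.exists_max f
  have hfj := h (f j) hj j
  refine (hj i).trans ?_
  rw [le_div_iff₀ (by linarith)]
  linarith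

lemma weighted_sum_le {ι : Type*} (t : Finset ι) (p f : ι → ℝ) {B : ℝ} (hp : ∀ i ∈ t, 0 ≤ p i)
    (hp1 : ∑ i ∈ t, p i = 1) (hf : ∀ i ∈ t, f i ≤ B) : ∑ i ∈ t, p i * f i ≤ B :=
  calc ∑ i ∈ t, p i * f i ≤ ∑ i ∈ t, p i * B :=
        sum_le_sum fun i hi => mul_le_mul_of_nonneg_left (hf i hi) (hp i hi)
    _ = B := by rw [← sum_mul, hp1, one_mul]

lemma le_weighted_sum {ι : Type*} (t : Finset ι) (p f : ι → ℝ) {B : ℝ} (hp : ∀ i ∈ t, 0 ≤ p i)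
    (hp1 : ∑ i ∈ t, p i = 1) (hf : ∀ i ∈ t, B ≤ f i) : B ≤ ∑ i ∈ t, p i * f i :=
  calc B = ∑ i ∈ t, p i * B := by rw [← sum_mul, hp1, one_mul]
    _ ≤ ∑ i ∈ t, p i * f i :=
        sum_le_sum fun i hi => mul_le_mul_of_nonneg_left (hf i hi) (hp i hi)

lemma abs_weighted_sum_sub_le {ι : Type*} (t : Finset ι) (p f g : ι → ℝ) {B : ℝ}
    (hp : ∀ i ∈ t, 0 ≤ p i) (hp1 : ∑ i ∈ t, p i = 1) (hfg : ∀ i ∈ t, |f i - g i| ≤ B) :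
    |∑ i ∈ t, p i * f i - ∑ i ∈ t, p i * g i| ≤ B := by
  have hsub : ∑ i ∈ t, p i * f i - ∑ i ∈ t, p i * g i = ∑ i ∈ t, p i * (f i - g i) := by
    simp only [mul_sub, sum_sub_distrib]
  rw [hsub, abs_le]
  exact ⟨le_weighted_sum t p _ hp hp1 fun i hi => (abs_le.1 (hfg i hi)).1,
    weighted_sum_le t p _ hp hp1 fun i hi => (abs_le.1 (hfg i hi)).2⟩

lemma abs_sup'_sub_sup'_le {ι : Type*} (t : Finset ι) (ht : t.Nonempty) (f g : ι → ℝ) {B : ℝ}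
    (h : ∀ i ∈ t, |f i - g i| ≤ B) : |t.sup' ht f - t.sup' ht g| ≤ B := by
  rw [abs_sub_le_iff, sub_le_iff_le_add, sub_le_iff_le_add]
  constructor <;> refine sup'_le ht _ fun i hi => ?_
  · linarith [(abs_le.1 (h i hi)).2, le_sup' g hi]
  · linarith [(abs_le.1 (h i hi)).1, le_sup' f hi]

/-- Aggregating the transition weights along `φ` amounts to pulling the value function back. -/
lemma sum_aggregated_mul {S X : Type*} [Fintype S] [Fintype X] [DecidableEq X] (φ : S → X)
    (t : Finset S) (w : S → ℝ) (P : S → S → ℝ) (V : X → ℝ) :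
    ∑ y, (∑ s ∈ t, w s * ∑ s' ∈ univ.filter (fun s' => φ s' = y), P s s') * V y =
      ∑ s ∈ t, w s * ∑ s', P s s' * V (φ s') := by
  simp only [sum_mul]
  rw [sum_comm]
  refine sum_congr rfl fun s _ => ?_
  rw [← sum_fiberwise univ φ (fun s' => P s s' * V (φ s')), mul_sum]
  refine sum_congr rfl fun y _ => ?_
  rw [mul_assoc, sum_mul]
  congr 1
  refine sum_congr rfl fun s' hs' => ?_
  rw [(mem_filter.1 hs').2]

/-- If normalized quantities and their normalizers are close, so are the quantities. -/
lemma abs_sub_le_of_normalized {q₁ q₂ n₁ n₂ ε d C : ℝ} (hn₁ : 0 < n₁) (hn₂ : 0 < n₂)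
    (hC : n₁ ≤ C) (hq₂ : 0 ≤ q₂) (hq₂n : q₂ ≤ n₂)
    (hq : |q₁ / n₁ - q₂ / n₂| ≤ ε) (hn : |n₁ - n₂| ≤ d) : |q₁ - q₂| ≤ d + ε * C := by
  have heq : q₁ - q₂ = n₁ * (q₁ / n₁ - q₂ / n₂) + q₂ / n₂ * (n₁ - n₂) := by
    field_simp
    ring
  have h0 : 0 ≤ q₂ / n₂ := div_nonneg hq₂ hn₂.le
  have h1 : q₂ / n₂ ≤ 1 := (div_le_one hn₂).2 hq₂n
  calc |q₁ - q₂| ≤ n₁ * |q₁ / n₁ - q₂ / n₂| + q₂ / n₂ * |n₁ - n₂| := by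
        rw [heq]
        refine (abs_add_le _ _).trans_eq ?_
        rw [abs_mul, abs_mul, abs_of_pos hn₁, abs_of_nonneg h0]
    _ ≤ C * ε + 1 * d := by
        have hC0 : 0 ≤ C := hn₁.le.trans hC
        gcongr
    _ = d + ε * C := by ring

/-- For a `φ_{mult,ε}`-type approximate state abstraction (similar
multinomial distributions over optimal Q-values), co-aggregated states have similar optimal
action values, and the optimal abstract policy has bounded value loss. -/
theorem stmt_4
    {S Sφ A : Type} [Fintype S] [Fintype Sφ] [Fintype A]
    [Nonempty S] [Nonempty Sφ] [Nonempty A] [DecidableEq Sφ]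
    -- the ground MDP
    (R : S → A → ℝ) (T : S → A → S → ℝ) (γ RMax : ℝ)
    (hRMax : 0 < RMax)
    (hR : ∀ s a, 0 ≤ R s a ∧ R s a ≤ RMax)
    (hT0 : ∀ s a s', 0 ≤ T s a s')
    (hT1 : ∀ s a, ∑ s', T s a s' = 1)
    (hγ0 : 0 ≤ γ) (hγ1 : γ < 1)
    -- optimal value functions of the ground MDP (the unique Bellman fixed point)
    (Qstar : S → A → ℝ) (Vstar : S → ℝ)
    (hVstar : ∀ s, Vstar s = univ.sup' univ_nonempty (fun a => Qstar s a))
    (hQstar : ∀ s a, Qstar s a = R s a + γ * ∑ s', T s a s' * Vstar s')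
    -- the state abstraction and its weighting function
    (φ : S → Sφ) (hφ : Function.Surjective φ)
    (w : S → ℝ) (hw : ∀ s, 0 ≤ w s ∧ w s ≤ 1)
    (hwsum : ∀ x : Sφ, ∑ s ∈ univ.filter (fun s => φ s = x), w s = 1)
    -- the induced abstract MDP
    (Rφ : Sφ → A → ℝ) (Tφ : Sφ → A → Sφ → ℝ)
    (hRφ : ∀ x a, Rφ x a = ∑ s ∈ univ.filter (fun s => φ s = x), w s * R s a)
    (hTφ : ∀ x a y, Tφ x a y =
      ∑ s ∈ univ.filter (fun s => φ s = x), w s *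
        ∑ s' ∈ univ.filter (fun s' => φ s' = y), T s a s')
    -- optimal value functions of the abstract MDP (the unique Bellman fixed point)
    (Qφ : Sφ → A → ℝ) (Vφ : Sφ → ℝ)
    (hVφ : ∀ x, Vφ x = univ.sup' univ_nonempty (fun a => Qφ x a))
    (hQφ : ∀ x a, Qφ x a = Rφ x a + γ * ∑ y, Tφ x a y * Vφ y)
    -- the normalizing terms are positive
    (hN : ∀ s : S, 0 < ∑ b, Qstar s b)
    -- ε-similarity of the multinomial distributions over optimal Q-values
    (ε k : ℝ) (hε : 0 ≤ ε) (hk : 0 ≤ k)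
    (hsim : ∀ s₁ s₂, φ s₁ = φ s₂ → ∀ a,
      |Qstar s₁ a / (∑ b, Qstar s₁ b) - Qstar s₂ a / (∑ b, Qstar s₂ b)| ≤ ε)
    (hsimN : ∀ s₁ s₂, φ s₁ = φ s₂ → |(∑ b, Qstar s₁ b) - (∑ b, Qstar s₂ b)| ≤ k * ε)
    -- an optimal deterministic policy of the abstract MDP
    (πφ : Sφ → A) (hπφ : ∀ x, Qφ x (πφ x) = Vφ x)
    -- the ground value function of the induced ground policy `πφ ∘ φ`
    (Vπ : S → ℝ)
    (hVπ : ∀ s, Vπ s = R s (πφ (φ s)) + γ * ∑ s', T s (πφ (φ s)) s' * Vπ s') :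
    (∀ s₁ s₂, φ s₁ = φ s₂ → ∀ a,
      |Qstar s₁ a - Qstar s₂ a| ≤ ε * (k + (Fintype.card A : ℝ) * RMax / (1 - γ))) ∧
    (∀ s, Vstar s - Vπ s ≤
      2 * ε * (k + (Fintype.card A : ℝ) * RMax / (1 - γ)) / (1 - γ) ^ 2) := by
  have hγ' : 0 < 1 - γ := by linarith
  have hQle : ∀ s a, Qstar s a ≤ Vstar s := fun s a => by
    rw [hVstar]
    exact le_sup' (fun a => Qstar s a) (mem_univ a)
  have hVnonneg : ∀ s, 0 ≤ Vstar s := by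
    have hneg := le_div_one_sub_of_contracting (fun s => -Vstar s) (c := 0) hγ1 fun B hB s => by
      obtain ⟨a⟩ := ‹Nonempty A›
      have havg := le_weighted_sum univ (T s a) Vstar (B := -B) (fun s' _ => hT0 s a s') (hT1 s a)
        fun s' _ => by linarith [hB s']
      have := mul_le_mul_of_nonneg_left havg hγ0
      linarith [hQle s a, hQstar s a, (hR s a).1]
    intro s
    have := hneg s
    rw [zero_div] at this
    linarith
  have hQnonneg : ∀ s a, 0 ≤ Qstar s a := fun s a => by
    rw [hQstar]
    exact add_nonneg (hR s a).1
      (mul_nonneg hγ0 (sum_nonneg fun s' _ => mul_nonneg (hT0 s a s') (hVnonneg s')))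
  have hVbound : ∀ s, Vstar s ≤ RMax / (1 - γ) :=
    le_div_one_sub_of_contracting Vstar hγ1 fun B hB s => by
      rw [hVstar s]
      refine sup'_le _ _ fun a _ => ?_
      have havg := weighted_sum_le univ (T s a) Vstar (fun s' _ => hT0 s a s') (hT1 s a)
        fun s' _ => hB s'
      have := mul_le_mul_of_nonneg_left havg hγ0
      linarith [hQstar s a, (hR s a).2]
  have hNbound : ∀ s, ∑ b, Qstar s b ≤ (Fintype.card A : ℝ) * RMax / (1 - γ) := fun s => by
    calc ∑ b, Qstar s b ≤ ∑ _b : A, RMax / (1 - γ) :=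
          sum_le_sum fun b _ => (hQle s b).trans (hVbound s)
      _ = (Fintype.card A : ℝ) * RMax / (1 - γ) := by simp [mul_div_assoc]
  have hQsim : ∀ s₁ s₂, φ s₁ = φ s₂ → ∀ a,
      |Qstar s₁ a - Qstar s₂ a| ≤ ε * (k + (Fintype.card A : ℝ) * RMax / (1 - γ)) := by
    intro s₁ s₂ h a
    refine (abs_sub_le_of_normalized (hN s₁) (hN s₂) (hNbound s₁) (hQnonneg s₂ a)
      (single_le_sum (fun b _ => hQnonneg s₂ b) (mem_univ a)) (hsim s₁ s₂ h a)
      (hsimN s₁ s₂ h)).trans_eq ?_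
    ring
  refine ⟨hQsim, ?_⟩
  set δ := ε * (k + (Fintype.card A : ℝ) * RMax / (1 - γ)) with hδ
  have hQφ_avg : ∀ x a, Qφ x a = ∑ s ∈ univ.filter (fun s => φ s = x),
      w s * (R s a + γ * ∑ s', T s a s' * Vφ (φ s')) := by
    intro x a
    rw [hQφ, hRφ]
    simp only [hTφ]
    rw [sum_aggregated_mul φ _ w (fun s s' => T s a s') Vφ, mul_sum, ← sum_add_distrib]
    exact sum_congr rfl fun s _ => by ring
  have hQdiff : ∀ s a, |Qstar s a - Qφ (φ s) a| ≤ δ / (1 - γ) := by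
    have hpair := le_div_one_sub_of_contracting
      (fun p : S × A => |Qstar p.1 p.2 - Qφ (φ p.1) p.2|) (c := δ) hγ1 fun B hB p => by
        obtain ⟨s, a⟩ := p
        have hVdiff : ∀ s', |Vstar s' - Vφ (φ s')| ≤ B := fun s' => by
          rw [hVstar, hVφ]
          exact abs_sup'_sub_sup'_le _ _ _ _ fun b _ => hB (s', b)
        have hw0 : ∀ s' ∈ univ.filter (fun s' => φ s' = φ s), 0 ≤ w s' := fun s' _ => (hw s').1
        have hclass := abs_weighted_sum_sub_le _ w (fun _ => Qstar s a) (fun s' => Qstar s' a)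
          hw0 (hwsum (φ s)) fun s' hs' => hQsim s s' (mem_filter.1 hs').2.symm a
        rw [← sum_mul, hwsum, one_mul] at hclass
        have hback := abs_weighted_sum_sub_le _ w (fun s' => Qstar s' a)
          (fun s' => R s' a + γ * ∑ s'', T s' a s'' * Vφ (φ s'')) (B := γ * B)
          hw0 (hwsum (φ s)) fun s' _ => by
            rw [hQstar, add_sub_add_left_eq_sub, ← mul_sub, abs_mul, abs_of_nonneg hγ0]
            exact mul_le_mul_of_nonneg_left (abs_weighted_sum_sub_le _ _ _ _
              (fun s'' _ => hT0 s' a s'') (hT1 s' a) fun s'' _ => hVdiff s'') hγ0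
        rw [← hQφ_avg] at hback
        exact (abs_sub_le _ _ _).trans (add_le_add hclass hback)
    exact fun s a => hpair (s, a)
  have hgreedy : ∀ s, Vstar s - Qstar s (πφ (φ s)) ≤ 2 * (δ / (1 - γ)) := fun s => by
    have hV : |Vstar s - Vφ (φ s)| ≤ δ / (1 - γ) := by
      rw [hVstar, hVφ]
      exact abs_sup'_sub_sup'_le _ _ _ _ fun b _ => hQdiff s b
    linarith [(abs_le.1 hV).2, (abs_le.1 (hQdiff s (πφ (φ s)))).1, hπφ (φ s)]
  intro s
  have hloss := le_div_one_sub_of_contracting (fun s => Vstar s - Vπ s)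
    (c := 2 * (δ / (1 - γ))) hγ1 (fun B hB s => by
    have havg := weighted_sum_le univ (T s (πφ (φ s))) (fun s' => Vstar s' - Vπ s')
      (fun s' _ => hT0 s _ s') (hT1 s _) fun s' _ => hB s'
    simp only [mul_sub, sum_sub_distrib] at havg
    have := mul_le_mul_of_nonneg_left havg hγ0
    linarith [hgreedy s, hQstar s (πφ (φ s)), hVπ s]) s
  refine hloss.trans_eq ?_
  rw [hδ]
  field_simp
end

section
/- Let M = (S, A, R, T, γ) be a finite MDP, d > 0, and φ : S → S_φ a state abstraction with weighting function w such that whenever φ(s1) = φ(s2), ⌈Q*(s1,a)/d⌉ = ⌈Q*(s2,a)/d⌉ for every action a. Then (i) whenever φ(s1)=φ(s2), for all a, |Q*(s1,a) − Q*(s2,a)| ≤ d; and (ii) for an optimal deterministic policy π*_φ of the abstract MDP M_φ, for every state s, V*(s) − V^{π*_φ∘φ}(s) ≤ 2d/(1−γ)². -/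
open Finset

/-- A finite family whose upper bounds improve under `M ↦ c + γ * M` lies below the fixed point. -/
lemma le_div_of_forall_le_add_mul {ι : Type*} [Finite ι] {f : ι → ℝ} {c γ : ℝ} (hγ : γ < 1)
    (h : ∀ M, (∀ i, f i ≤ M) → ∀ i, f i ≤ c + γ * M) (i : ι) : f i ≤ c / (1 - γ) := by
  have : Nonempty ι := ⟨i⟩
  obtain ⟨j, hj⟩ := Finite.exists_max f
  have hj' := h (f j) hj j
  refine (hj i).trans ?_
  rw [le_div_iff₀ (by linarith)]
  linarith

lemma sum_mul_le_of_sum_eq_one {ι : Type*} {s : Finset ι} {p g : ι → ℝ} {M : ℝ}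
    (hp : ∀ i ∈ s, 0 ≤ p i) (hp1 : ∑ i ∈ s, p i = 1) (hg : ∀ i ∈ s, g i ≤ M) :
    ∑ i ∈ s, p i * g i ≤ M := by
  calc ∑ i ∈ s, p i * g i ≤ ∑ i ∈ s, p i * M :=
        sum_le_sum fun i hi => mul_le_mul_of_nonneg_left (hg i hi) (hp i hi)
    _ = M := by rw [← sum_mul, hp1, one_mul]

lemma abs_sum_mul_le_of_sum_eq_one {ι : Type*} {s : Finset ι} {p g : ι → ℝ} {M : ℝ}
    (hp : ∀ i ∈ s, 0 ≤ p i) (hp1 : ∑ i ∈ s, p i = 1) (hg : ∀ i ∈ s, |g i| ≤ M) :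
    |∑ i ∈ s, p i * g i| ≤ M := by
  refine (abs_sum_le_sum_abs _ _).trans ?_
  calc ∑ i ∈ s, |p i * g i| = ∑ i ∈ s, p i * |g i| :=
        sum_congr rfl fun i hi => by rw [abs_mul, abs_of_nonneg (hp i hi)]
    _ ≤ M := sum_mul_le_of_sum_eq_one hp hp1 hg

lemma sup'_le_sup'_add {ι : Type*} {s : Finset ι} (hs : s.Nonempty) {f g : ι → ℝ} {M : ℝ}
    (h : ∀ i ∈ s, f i ≤ g i + M) : s.sup' hs f ≤ s.sup' hs g + M :=
  sup'_le hs _ fun i hi => (h i hi).trans (add_le_add_left (le_sup' g hi) M)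

lemma abs_sup'_sub_sup'_le_s5 {ι : Type*} {s : Finset ι} (hs : s.Nonempty) {f g : ι → ℝ} {M : ℝ}
    (h : ∀ i ∈ s, |f i - g i| ≤ M) : |s.sup' hs f - s.sup' hs g| ≤ M := by
  have h₁ : s.sup' hs f ≤ s.sup' hs g + M :=
    sup'_le_sup'_add hs fun i hi => by linarith [(abs_le.1 (h i hi)).2]
  have h₂ : s.sup' hs g ≤ s.sup' hs f + M :=
    sup'_le_sup'_add hs fun i hi => by linarith [(abs_le.1 (h i hi)).1]
  exact abs_le.2 ⟨by linarith, by linarith⟩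

lemma abs_sub_le_of_ceil_div_eq {x y d : ℝ} (hd : 0 < d) (h : ⌈x / d⌉ = ⌈y / d⌉) :
    |x - y| ≤ d := by
  have hx := Int.le_ceil (x / d)
  have hx' := Int.ceil_lt_add_one (x / d)
  have hy := Int.le_ceil (y / d)
  have hy' := Int.ceil_lt_add_one (y / d)
  rw [h] at hx hx'
  have key : |x / d - y / d| ≤ 1 := abs_le.2 ⟨by linarith, by linarith⟩
  rwa [← sub_div, abs_div, abs_of_pos hd, div_le_one hd] at key

/-- (Theorem on `φ_{Q*_d}`.)  The transitive, bucket-based abstraction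
`φ_{Q*_d}` is a subclass of `φ_{Q*_ε}` with `ε = d`, and hence its optimal abstract policy
has value loss at most `2d/(1-γ)²`. -/
theorem stmt_5
    {S Sφ A : Type} [Fintype S] [Fintype Sφ] [Fintype A]
    [Nonempty S] [Nonempty Sφ] [Nonempty A] [DecidableEq Sφ]
    -- the ground MDP
    (R : S → A → ℝ) (T : S → A → S → ℝ) (γ RMax : ℝ)
    (hRMax : 0 < RMax)
    (hR : ∀ s a, 0 ≤ R s a ∧ R s a ≤ RMax)
    (hT0 : ∀ s a s', 0 ≤ T s a s')
    (hT1 : ∀ s a, ∑ s', T s a s' = 1)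
    (hγ0 : 0 ≤ γ) (hγ1 : γ < 1)
    -- optimal value functions of the ground MDP (the unique Bellman fixed point)
    (Qstar : S → A → ℝ) (Vstar : S → ℝ)
    (hVstar : ∀ s, Vstar s = univ.sup' univ_nonempty (fun a => Qstar s a))
    (hQstar : ∀ s a, Qstar s a = R s a + γ * ∑ s', T s a s' * Vstar s')
    -- the state abstraction and its weighting function
    (φ : S → Sφ) (hφ : Function.Surjective φ)
    (w : S → ℝ) (hw : ∀ s, 0 ≤ w s ∧ w s ≤ 1)
    (hwsum : ∀ x : Sφ, ∑ s ∈ univ.filter (fun s => φ s = x), w s = 1)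
    -- the induced abstract MDP
    (Rφ : Sφ → A → ℝ) (Tφ : Sφ → A → Sφ → ℝ)
    (hRφ : ∀ x a, Rφ x a = ∑ s ∈ univ.filter (fun s => φ s = x), w s * R s a)
    (hTφ : ∀ x a y, Tφ x a y =
      ∑ s ∈ univ.filter (fun s => φ s = x), w s *
        ∑ s' ∈ univ.filter (fun s' => φ s' = y), T s a s')
    -- optimal value functions of the abstract MDP (the unique Bellman fixed point)
    (Qφ : Sφ → A → ℝ) (Vφ : Sφ → ℝ)
    (hVφ : ∀ x, Vφ x = univ.sup' univ_nonempty (fun a => Qφ x a))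
    (hQφ : ∀ x a, Qφ x a = Rφ x a + γ * ∑ y, Tφ x a y * Vφ y)
    -- co-aggregated states have their optimal Q-values in the same length-d buckets
    (d : ℝ) (hd : 0 < d)
    (hsim : ∀ s₁ s₂, φ s₁ = φ s₂ → ∀ a, ⌈Qstar s₁ a / d⌉ = ⌈Qstar s₂ a / d⌉)
    -- an optimal deterministic policy of the abstract MDP
    (πφ : Sφ → A) (hπφ : ∀ x, Qφ x (πφ x) = Vφ x)
    -- the ground value function of the induced ground policy `πφ ∘ φ`
    (Vπ : S → ℝ)
    (hVπ : ∀ s, Vπ s = R s (πφ (φ s)) + γ * ∑ s', T s (πφ (φ s)) s' * Vπ s') :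
    (∀ s₁ s₂, φ s₁ = φ s₂ → ∀ a, |Qstar s₁ a - Qstar s₂ a| ≤ d) ∧
    (∀ s, Vstar s - Vπ s ≤ 2 * d / (1 - γ) ^ 2) := by
  have hQ : ∀ s₁ s₂, φ s₁ = φ s₂ → ∀ a, |Qstar s₁ a - Qstar s₂ a| ≤ d :=
    fun s₁ s₂ h a => abs_sub_le_of_ceil_div_eq hd (hsim s₁ s₂ h a)
  refine ⟨hQ, ?_⟩
  have hQφ' : ∀ x a, Qφ x a =
      ∑ s ∈ univ.filter (fun s => φ s = x), w s * (R s a + γ * ∑ s', T s a s' * Vφ (φ s')) := by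
    intro x a
    have hpush : ∀ s, ∑ y, (∑ s' ∈ univ.filter (fun s' => φ s' = y), T s a s') * Vφ y
        = ∑ s', T s a s' * Vφ (φ s') := by
      intro s
      rw [← sum_fiberwise univ φ]
      refine sum_congr rfl fun y _ => ?_
      rw [sum_mul]
      exact sum_congr rfl fun s' hs' => by rw [(mem_filter.1 hs').2]
    have hT : ∑ y, Tφ x a y * Vφ y = ∑ s ∈ univ.filter (fun s => φ s = x),
        w s * ∑ s', T s a s' * Vφ (φ s') := by
      simp_rw [hTφ, sum_mul _ _ (Vφ _)]
      rw [sum_comm]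
      refine sum_congr rfl fun s _ => ?_
      rw [← hpush, mul_sum]
      exact sum_congr rfl fun y _ => mul_assoc _ _ _
    rw [hQφ, hRφ, hT, mul_sum, ← sum_add_distrib]
    exact sum_congr rfl fun s _ => by ring
  have hclose : ∀ i : S × A, |Qφ (φ i.1) i.2 - Qstar i.1 i.2| ≤ d / (1 - γ) := by
    refine le_div_of_forall_le_add_mul hγ1 ?_
    rintro M hM ⟨s, a⟩
    have hV : ∀ s', |Vφ (φ s') - Vstar s'| ≤ M := fun s' => by
      rw [hVφ, hVstar]
      exact abs_sup'_sub_sup'_le_s5 _ fun b _ => hM (s', b)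
    have hsplit : Qφ (φ s) a - Qstar s a = ∑ t ∈ univ.filter (fun t => φ t = φ s), w t *
        ((Qstar t a - Qstar s a) + γ * ∑ s', T t a s' * (Vφ (φ s') - Vstar s')) := by
      have hs : Qstar s a = ∑ t ∈ univ.filter (fun t => φ t = φ s), w t * Qstar s a := by
        rw [← sum_mul, hwsum, one_mul]
      rw [hQφ']
      nth_rewrite 1 [hs]
      rw [← sum_sub_distrib]
      refine sum_congr rfl fun t _ => ?_
      rw [hQstar t a]
      simp_rw [mul_sub, sum_sub_distrib]
      ring
    change |Qφ (φ s) a - Qstar s a| ≤ _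
    rw [hsplit]
    refine abs_sum_mul_le_of_sum_eq_one (fun t _ => (hw t).1) (hwsum _) fun t ht => ?_
    refine (abs_add_le _ _).trans (add_le_add (hQ t s (mem_filter.1 ht).2 a) ?_)
    rw [abs_mul, abs_of_nonneg hγ0]
    exact mul_le_mul_of_nonneg_left
      (abs_sum_mul_le_of_sum_eq_one (fun s' _ => hT0 t a s') (hT1 t a) fun s' _ => hV s') hγ0
  have hgreedy : ∀ s, Vstar s - Qstar s (πφ (φ s)) ≤ 2 * (d / (1 - γ)) := by
    intro s
    have hV : |Vφ (φ s) - Vstar s| ≤ d / (1 - γ) := by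
      rw [hVφ, hVstar]
      exact abs_sup'_sub_sup'_le_s5 _ fun b _ => hclose (s, b)
    have hπ := hclose (s, πφ (φ s))
    rw [hπφ] at hπ
    linarith [(abs_le.1 hV).1, (abs_le.1 hπ).2]
  have hloss : ∀ s, Vstar s - Vπ s ≤ 2 * (d / (1 - γ)) / (1 - γ) := by
    refine le_div_of_forall_le_add_mul hγ1 fun M hM s => ?_
    have hstep : Qstar s (πφ (φ s)) - Vπ s =
        γ * ∑ s', T s (πφ (φ s)) s' * (Vstar s' - Vπ s') := by
      rw [hQstar, hVπ s]
      simp_rw [mul_sub, sum_sub_distrib]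
      ring
    have hsum : γ * ∑ s', T s (πφ (φ s)) s' * (Vstar s' - Vπ s') ≤ γ * M :=
      mul_le_mul_of_nonneg_left
        (sum_mul_le_of_sum_eq_one (fun s' _ => hT0 s _ s') (hT1 s _) fun s' _ => hM s') hγ0
    linarith [hgreedy s]
  intro s
  refine (hloss s).trans_eq ?_
  rw [← mul_div_assoc, div_div, sq]
end
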